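/- arXiv:math/0210461 — 2 statements merged into one kernel-verified Lean document; each statement's English description precedes it below -/
import Mathlib

section
/- Let k be a field and H a Hopf algebra over k with bijective antipode. An object M of the category of left-right Yetter-Drinfeld modules over H (or of the category of left-right Long dimodules over H) is finitely generated as a left H-module if and only if there exist a finite dimensional right H-comodule V and an H-linear H-colinear epimorphism π : H ⊗ V → M, where H ⊗ V carries the Yetter-Drinfeld (respectively Long dimodule) structure given by h(h' ⊗ v) = hh' ⊗ v and rho(h ⊗ v) = h_2 ⊗ v_0 ⊗ h_3 v_1 S^{-1}(h_1) (respectively rho(h ⊗ v) = h ⊗ v_0 ⊗ v_1). -/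
/-!
Common definitions for formalizing "Semisimplicity of the categories of
Yetter-Drinfeld modules and Long dimodules" (Caenepeel, Guédénon).
-/

open TensorProduct

noncomputable section
namespace YDPaper

section RingPart

variable (k H : Type) [CommRing k] [Ring H] [HopfAlgebra k H]

/-- `ρ : M →ₗ[k] M ⊗[k] H` is a (coassociative, counital) right `H`-comodule
structure on `M`. -/
def IsComod {M : Type} [AddCommGroup M] [Module k M] (ρ : M →ₗ[k] M ⊗[k] H) : Prop :=
  (∀ m : M, (TensorProduct.rid k M)
      ((LinearMap.lTensor M (Coalgebra.counit (R := k) (A := H))) (ρ m)) = m) ∧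
  (∀ m : M, (TensorProduct.assoc k M H H) ((LinearMap.rTensor H ρ) (ρ m)) =
      (LinearMap.lTensor M (Coalgebra.comul (R := k) (A := H))) (ρ m))

/-- The iterated comultiplication `h ↦ (h₁ ⊗ h₂) ⊗ h₃`. -/
def Delta2 : H →ₗ[k] (H ⊗[k] H) ⊗[k] H :=
  (LinearMap.rTensor H (Coalgebra.comul (R := k) (A := H))).comp
    (Coalgebra.comul (R := k) (A := H))

/-- The Yetter-Drinfeld compatibility condition
`ρ(h • m) = h₂ • m₀ ⊗ h₃ m₁ S⁻¹(h₁)`, expressed via arbitrary Sweedler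
decompositions of `Δ²(h)` and `ρ(m)` into finite sums of pure tensors. -/
def IsYDCompat (Sinv : H →ₗ[k] H) {M : Type} [AddCommGroup M] [Module k M] [Module H M]
    (ρ : M →ₗ[k] M ⊗[k] H) : Prop :=
  ∀ (h : H) (m : M) (s t : Finset ℕ) (a b c : ℕ → H) (m₀ : ℕ → M) (m₁ : ℕ → H),
    (∑ i ∈ s, (a i ⊗ₜ[k] b i) ⊗ₜ[k] c i) = Delta2 k H h →
    (∑ j ∈ t, m₀ j ⊗ₜ[k] m₁ j) = ρ m →
    ρ (h • m) = ∑ i ∈ s, ∑ j ∈ t, (b i • m₀ j) ⊗ₜ[k] (c i * m₁ j * Sinv (a i))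

/-- The `k`-linear map `m ↦ h • m`. -/
def smulMap {M : Type} [AddCommGroup M] [Module k M] [Module H M] [SMulCommClass H k M]
    (h : H) : M →ₗ[k] M where
  toFun m := h • m
  map_add' := smul_add h
  map_smul' c m := (smul_comm h c m)

/-- The Long dimodule compatibility condition `ρ(h • m) = h • m₀ ⊗ m₁`. -/
def IsLongCompat {M : Type} [AddCommGroup M] [Module k M] [Module H M] [SMulCommClass H k M]
    (ρ : M →ₗ[k] M ⊗[k] H) : Prop :=
  ∀ (h : H) (m : M), ρ (h • m) = (LinearMap.rTensor H (smulMap k H h)) (ρ m)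

/-- Morphisms in the categories of Yetter-Drinfeld modules and of Long dimodules:
`H`-linear and `H`-colinear maps. -/
def IsHom {A B : Type} [AddCommGroup A] [Module k A] [Module H A]
    [AddCommGroup B] [Module k B] [Module H B]
    (ρA : A →ₗ[k] A ⊗[k] H) (ρB : B →ₗ[k] B ⊗[k] H) (f : A →ₗ[k] B) : Prop :=
  (∀ (h : H) (a : A), f (h • a) = h • f a) ∧
  ρB.comp f = (LinearMap.rTensor H f).comp ρA

/-- `H`-colinearity of a `k`-linear map between right `H`-comodules. -/
def IsColin {A B : Type} [AddCommGroup A] [Module k A]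
    [AddCommGroup B] [Module k B]
    (ρA : A →ₗ[k] A ⊗[k] H) (ρB : B →ₗ[k] B ⊗[k] H) (f : A →ₗ[k] B) : Prop :=
  ρB.comp f = (LinearMap.rTensor H f).comp ρA

/-- A bundled left-right Yetter-Drinfeld module over `H` (with chosen inverse `Sinv`
of the antipode). -/
structure YDCat (Sinv : H →ₗ[k] H) where
  M : Type
  [iAdd : AddCommGroup M]
  [iModk : Module k M]
  [iModH : Module H M]
  [iTower : IsScalarTower k H M]
  [iComm : SMulCommClass H k M]
  ρ : M →ₗ[k] M ⊗[k] H
  comod : IsComod k H ρ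
  compat : IsYDCompat k H Sinv ρ

attribute [instance] YDCat.iAdd YDCat.iModk YDCat.iModH YDCat.iTower YDCat.iComm

/-- A bundled left-right Long dimodule over `H`. -/
structure LongCat where
  M : Type
  [iAdd : AddCommGroup M]
  [iModk : Module k M]
  [iModH : Module H M]
  [iTower : IsScalarTower k H M]
  [iComm : SMulCommClass H k M]
  ρ : M →ₗ[k] M ⊗[k] H
  comod : IsComod k H ρ
  compat : IsLongCompat k H ρ

attribute [instance] LongCat.iAdd LongCat.iModk LongCat.iModH LongCat.iTower LongCat.iComm

/-- A bundled right `H`-comodule. -/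
structure ComodCat where
  V : Type
  [iAdd : AddCommGroup V]
  [iModk : Module k V]
  ρ : V →ₗ[k] V ⊗[k] H
  comod : IsComod k H ρ

attribute [instance] ComodCat.iAdd ComodCat.iModk

section Subobjects

variable {k H}
variable {M : Type} [AddCommGroup M] [Module k M] [Module H M] [IsScalarTower k H M]

/-- A subobject in the category of Yetter-Drinfeld modules (or Long dimodules):
an `H`-submodule which is stable under the coaction, i.e. `ρ(p) ⊆ p ⊗ H`. -/
def IsSubobject (ρ : M →ₗ[k] M ⊗[k] H) (p : Submodule H M) : Prop :=
  ∀ m ∈ p, ρ m ∈ LinearMap.range (LinearMap.rTensor H (p.restrictScalars k).subtype)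

/-- A simple subobject: a nonzero coaction-stable `H`-submodule with no proper
nonzero coaction-stable `H`-submodules. -/
def IsSimpleSubobject (ρ : M →ₗ[k] M ⊗[k] H) (p : Submodule H M) : Prop :=
  IsSubobject ρ p ∧ p ≠ ⊥ ∧
    ∀ q : Submodule H M, IsSubobject ρ q → q ≤ p → q = ⊥ ∨ q = p

/-- `M` is the (internal) direct sum of a family of simple subobjects which are
finitely generated as `H`-modules. -/
def IsSemisimpleObj (ρ : M →ₗ[k] M ⊗[k] H) : Prop :=
  ∃ (ι : Type) (S : ι → Submodule H M),
    (∀ i, IsSimpleSubobject ρ (S i) ∧ (S i).FG) ∧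
    iSupIndep S ∧ (⨆ i, S i) = ⊤

end Subobjects

section Subcomodules

variable {k H}
variable {V : Type} [AddCommGroup V] [Module k V]

/-- A subcomodule: a `k`-submodule stable under the coaction. -/
def IsSubcomod (ρ : V →ₗ[k] V ⊗[k] H) (p : Submodule k V) : Prop :=
  ∀ v ∈ p, ρ v ∈ LinearMap.range (LinearMap.rTensor H p.subtype)

/-- A simple subcomodule. -/
def IsSimpleSubcomod (ρ : V →ₗ[k] V ⊗[k] H) (p : Submodule k V) : Prop :=
  IsSubcomod ρ p ∧ p ≠ ⊥ ∧
    ∀ q : Submodule k V, IsSubcomod ρ q → q ≤ p → q = ⊥ ∨ q = p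

/-- A comodule is semisimple if it is the internal direct sum of a family of simple
subcomodules. -/
def IsSemisimpleComod (ρ : V →ₗ[k] V ⊗[k] H) : Prop :=
  ∃ (ι : Type) (S : ι → Submodule k V),
    (∀ i, IsSimpleSubcomod ρ (S i)) ∧ iSupIndep S ∧ (⨆ i, S i) = ⊤

end Subcomodules

/-- `H` is cosemisimple: every right `H`-comodule is a direct sum of simple
subcomodules. -/
def Cosemisimple : Prop := ∀ C : ComodCat k H, IsSemisimpleComod C.ρ

section Coinv

variable {k H}
variable {A B : Type} [AddCommGroup A] [Module k A] [AddCommGroup B] [Module k B]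

/-- The coinvariants `M^{co H} = { m | ρ m = m ⊗ 1 }` of a right `H`-comodule. -/
def coinv (ρ : A →ₗ[k] A ⊗[k] H) : Submodule k A :=
  LinearMap.ker (ρ - (TensorProduct.mk k A H).flip 1)

lemma mem_coinv {ρ : A →ₗ[k] A ⊗[k] H} {a : A} :
    a ∈ coinv ρ ↔ ρ a = a ⊗ₜ[k] (1 : H) := by
  simp [coinv, LinearMap.mem_ker, sub_eq_zero]

/-- The map induced on coinvariants by an `H`-colinear map. -/
def coinvMap {ρA : A →ₗ[k] A ⊗[k] H} {ρB : B →ₗ[k] B ⊗[k] H} (f : A →ₗ[k] B)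
    (hf : IsColin k H ρA ρB f) : ↥(coinv ρA) →ₗ[k] ↥(coinv ρB) :=
  f.restrict (fun a ha => by
    have h1 : ρA a = a ⊗ₜ[k] (1 : H) := mem_coinv.1 ha
    have h2 : ρB (f a) = (LinearMap.rTensor H f) (ρA a) := by
      have := congrArg (fun (g : A →ₗ[k] B ⊗[k] H) => g a) hf
      simpa using this
    rw [mem_coinv, h2, h1, LinearMap.rTensor_tmul])

end Coinv

/-- Exactness of the coinvariants functor on the category of Yetter-Drinfeld
modules. -/
def CoinvExactYD (Sinv : H →ₗ[k] H) : Prop :=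
  ∀ (A B C : YDCat k H Sinv) (f : A.M →ₗ[k] B.M) (g : B.M →ₗ[k] C.M)
    (hf : IsHom k H A.ρ B.ρ f) (hg : IsHom k H B.ρ C.ρ g),
    Function.Injective f → Function.Surjective g →
    LinearMap.range f = LinearMap.ker g →
    Function.Injective (coinvMap f hf.2) ∧
    LinearMap.range (coinvMap f hf.2) = LinearMap.ker (coinvMap g hg.2) ∧
    Function.Surjective (coinvMap g hg.2)

/-- Exactness of the coinvariants functor on the category of right `H`-comodules. -/
def CoinvExactComod : Prop :=
  ∀ (A B C : ComodCat k H) (f : A.V →ₗ[k] B.V) (g : B.V →ₗ[k] C.V)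
    (hf : IsColin k H A.ρ B.ρ f) (hg : IsColin k H B.ρ C.ρ g),
    Function.Injective f → Function.Surjective g →
    LinearMap.range f = LinearMap.ker g →
    Function.Injective (coinvMap f hf) ∧
    LinearMap.range (coinvMap f hf) = LinearMap.ker (coinvMap g hg) ∧
    Function.Surjective (coinvMap g hg)

section Eval

variable {k H}
variable {M N : Type} [AddCommGroup M] [Module k M] [Module H M]
  [IsScalarTower k H M] [SMulCommClass H k M]
  [AddCommGroup N] [Module k N] [Module H N] [IsScalarTower k H N] [SMulCommClass H k N]

/-- Evaluation at `m` of `H`-linear maps, as a `k`-linear map. -/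
def evalAtH (m : M) : (M →ₗ[H] N) →ₗ[k] N where
  toFun f := f m
  map_add' _ _ := rfl
  map_smul' _ _ := rfl

/-- Evaluation at `m` of `k`-linear maps, as a `k`-linear map. -/
def evalAtK {V : Type} [AddCommGroup V] [Module k V] (v : V) :
    (V →ₗ[k] N) →ₗ[k] N where
  toFun f := f v
  map_add' _ _ := rfl
  map_smul' _ _ := rfl

/-- Contraction `N ⊗ H → N` along a functional `φ : H → k`. -/
def contract (φ : H →ₗ[k] k) : N ⊗[k] H →ₗ[k] N :=
  (TensorProduct.rid k N).toLinearMap.comp (LinearMap.lTensor N φ)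

/-- Post-composition with an `H`-linear map, as a `k`-linear map
`Hom_H(X, M) → Hom_H(X, N)`; here `X` is the (implicit) source. -/
def postcompH {X : Type} [AddCommGroup X] [Module k X] [Module H X]
    [IsScalarTower k H X] [SMulCommClass H k X]
    (f : M →ₗ[k] N) (hf : ∀ (h : H) (m : M), f (h • m) = h • f m) :
    (X →ₗ[H] M) →ₗ[k] (X →ₗ[H] N) where
  toFun φ :=
    { toFun := fun x => f (φ x)
      map_add' := fun x y => by simp
      map_smul' := fun h x => by simp [hf] }
  map_add' φ ψ := by ext x; simp
  map_smul' c φ := by ext x; simp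

end Eval

/-- Condition (†) for the category of Yetter-Drinfeld modules: for every
Yetter-Drinfeld module `X` which is finitely generated as a left `H`-module,
the functor `Hom_H(X, -)` is exact on the category of Yetter-Drinfeld modules. -/
def DaggerYD (Sinv : H →ₗ[k] H) : Prop :=
  ∀ X : YDCat k H Sinv, Module.Finite H X.M →
  ∀ (A B C : YDCat k H Sinv) (f : A.M →ₗ[k] B.M) (g : B.M →ₗ[k] C.M)
    (hf : IsHom k H A.ρ B.ρ f) (hg : IsHom k H B.ρ C.ρ g),
    Function.Injective f → Function.Surjective g →
    LinearMap.range f = LinearMap.ker g →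
    Function.Injective (postcompH (X := X.M) f hf.1) ∧
    LinearMap.range (postcompH (X := X.M) f hf.1) =
      LinearMap.ker (postcompH (X := X.M) g hg.1) ∧
    Function.Surjective (postcompH (X := X.M) g hg.1)

/-- Condition (†) for the category of Long dimodules. -/
def DaggerLong : Prop :=
  ∀ X : LongCat k H, Module.Finite H X.M →
  ∀ (A B C : LongCat k H) (f : A.M →ₗ[k] B.M) (g : B.M →ₗ[k] C.M)
    (hf : IsHom k H A.ρ B.ρ f) (hg : IsHom k H B.ρ C.ρ g),
    Function.Injective f → Function.Surjective g →
    LinearMap.range f = LinearMap.ker g →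
    Function.Injective (postcompH (X := X.M) f hf.1) ∧
    LinearMap.range (postcompH (X := X.M) f hf.1) =
      LinearMap.ker (postcompH (X := X.M) g hg.1) ∧
    Function.Surjective (postcompH (X := X.M) g hg.1)

/-- Projective object in the category of Yetter-Drinfeld modules. -/
def IsProjectiveYD (Sinv : H →ₗ[k] H) (P : YDCat k H Sinv) : Prop :=
  ∀ (A B : YDCat k H Sinv) (g : A.M →ₗ[k] B.M) (f : P.M →ₗ[k] B.M),
    IsHom k H A.ρ B.ρ g → Function.Surjective g → IsHom k H P.ρ B.ρ f →
    ∃ l : P.M →ₗ[k] A.M, IsHom k H P.ρ A.ρ l ∧ g.comp l = f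

/-- Projective object in the category of Long dimodules. -/
def IsProjectiveLong (P : LongCat k H) : Prop :=
  ∀ (A B : LongCat k H) (g : A.M →ₗ[k] B.M) (f : P.M →ₗ[k] B.M),
    IsHom k H A.ρ B.ρ g → Function.Surjective g → IsHom k H P.ρ B.ρ f →
    ∃ l : P.M →ₗ[k] A.M, IsHom k H P.ρ A.ρ l ∧ g.comp l = f

/-- Injective object in the category of Yetter-Drinfeld modules. -/
def IsInjectiveYD (Sinv : H →ₗ[k] H) (I : YDCat k H Sinv) : Prop :=
  ∀ (A B : YDCat k H Sinv) (ι : A.M →ₗ[k] B.M) (f : A.M →ₗ[k] I.M),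
    IsHom k H A.ρ B.ρ ι → Function.Injective ι → IsHom k H A.ρ I.ρ f →
    ∃ g : B.M →ₗ[k] I.M, IsHom k H B.ρ I.ρ g ∧ g.comp ι = f

/-- Projective object in the category of right `H`-comodules. -/
def IsProjectiveComod (P : ComodCat k H) : Prop :=
  ∀ (A B : ComodCat k H) (g : A.V →ₗ[k] B.V) (f : P.V →ₗ[k] B.V),
    IsColin k H A.ρ B.ρ g → Function.Surjective g → IsColin k H P.ρ B.ρ f →
    ∃ l : P.V →ₗ[k] A.V, IsColin k H P.ρ A.ρ l ∧ g.comp l = f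

section HomLemmas

variable {k H}
variable {A B C : Type} [AddCommGroup A] [Module k A] [Module H A]
  [AddCommGroup B] [Module k B] [Module H B]
  [AddCommGroup C] [Module k C] [Module H C]

lemma IsHom.comp' {ρA : A →ₗ[k] A ⊗[k] H} {ρB : B →ₗ[k] B ⊗[k] H} {ρC : C →ₗ[k] C ⊗[k] H}
    {f : A →ₗ[k] B} {g : B →ₗ[k] C}
    (hf : IsHom k H ρA ρB f) (hg : IsHom k H ρB ρC g) :
    IsHom k H ρA ρC (g.comp f) := by
  refine ⟨fun h a => by simp [LinearMap.comp_apply, hf.1, hg.1], ?_⟩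
  calc ρC.comp (g.comp f) = (ρC.comp g).comp f := by rw [LinearMap.comp_assoc]
    _ = ((LinearMap.rTensor H g).comp ρB).comp f := by rw [hg.2]
    _ = (LinearMap.rTensor H g).comp (ρB.comp f) := by rw [LinearMap.comp_assoc]
    _ = (LinearMap.rTensor H g).comp ((LinearMap.rTensor H f).comp ρA) := by rw [hf.2]
    _ = ((LinearMap.rTensor H g).comp (LinearMap.rTensor H f)).comp ρA := by
          rw [LinearMap.comp_assoc]
    _ = (LinearMap.rTensor H (g.comp f)).comp ρA := by rw [LinearMap.rTensor_comp]

end HomLemmas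

section HomYD

variable {k H}
variable (Sinv : H →ₗ[k] H)

/-- The `k`-module of morphisms of Yetter-Drinfeld modules `Hom_H^H(A, B)`, as a
submodule of the `k`-linear maps. -/
def homYD (A B : YDCat k H Sinv) : Submodule k (A.M →ₗ[k] B.M) where
  carrier := {f | IsHom k H A.ρ B.ρ f}
  add_mem' := by
    rintro f g ⟨hf1, hf2⟩ ⟨hg1, hg2⟩
    refine ⟨fun h a => by simp [hf1, hg1, smul_add], ?_⟩
    rw [LinearMap.comp_add, LinearMap.rTensor_add, LinearMap.add_comp, hf2, hg2]
  zero_mem' := by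
    refine ⟨fun h a => by simp, ?_⟩
    rw [LinearMap.comp_zero, LinearMap.rTensor_zero, LinearMap.zero_comp]
  smul_mem' := by
    rintro c f ⟨hf1, hf2⟩
    refine ⟨fun h a => by
      rw [LinearMap.smul_apply, LinearMap.smul_apply, hf1, smul_comm], ?_⟩
    rw [LinearMap.comp_smul, LinearMap.rTensor_smul, LinearMap.smul_comp, hf2]

/-- Post-composition with a morphism of Yetter-Drinfeld modules, as a `k`-linear map
between morphism spaces. -/
def postcompYD {X B C : YDCat k H Sinv}
    (g : B.M →ₗ[k] C.M) (hg : IsHom k H B.ρ C.ρ g) :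
    ↥(homYD Sinv X B) →ₗ[k] ↥(homYD Sinv X C) where
  toFun f := ⟨g.comp f.1, IsHom.comp' f.2 hg⟩
  map_add' f g' := by ext x; simp
  map_smul' c f := by ext x; simp

/-- An injective resolution `0 → X → I⁰ → I¹ → ⋯` in the category of
Yetter-Drinfeld modules. -/
structure IsInjRes (X : YDCat k H Sinv) (I : ℕ → YDCat k H Sinv)
    (ε : X.M →ₗ[k] (I 0).M) (d : ∀ n, (I n).M →ₗ[k] (I (n + 1)).M) : Prop where
  eps_hom : IsHom k H X.ρ (I 0).ρ ε
  d_hom : ∀ n, IsHom k H (I n).ρ (I (n + 1)).ρ (d n)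
  inj : ∀ n, IsInjectiveYD k H Sinv (I n)
  mono : Function.Injective ε
  exact0 : LinearMap.range ε = LinearMap.ker (d 0)
  exact : ∀ n, LinearMap.range (d n) = LinearMap.ker (d (n + 1))

/-- A projective resolution `⋯ → P₁ → P₀ → X → 0` in the category of
Yetter-Drinfeld modules. -/
structure IsProjRes (X : YDCat k H Sinv) (P : ℕ → YDCat k H Sinv)
    (ε : (P 0).M →ₗ[k] X.M) (d : ∀ n, (P (n + 1)).M →ₗ[k] (P n).M) : Prop where
  eps_hom : IsHom k H (P 0).ρ X.ρ ε
  d_hom : ∀ n, IsHom k H (P (n + 1)).ρ (P n).ρ (d n)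
  proj : ∀ n, IsProjectiveYD k H Sinv (P n)
  epi : Function.Surjective ε
  exact0 : LinearMap.range (d 0) = LinearMap.ker ε
  exact : ∀ n, LinearMap.range (d (n + 1)) = LinearMap.ker (d n)

/-- The projective dimension of `X` in the category of Yetter-Drinfeld modules is
at most `n`. -/
def pdimLE (X : YDCat k H Sinv) (n : ℕ) : Prop :=
  ∃ (P : ℕ → YDCat k H Sinv) (ε : (P 0).M →ₗ[k] X.M)
    (d : ∀ m, (P (m + 1)).M →ₗ[k] (P m).M),
    IsProjRes Sinv X P ε d ∧ ∀ i, n < i → Subsingleton (P i).M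

/-- The injective dimension of `X` in the category of Yetter-Drinfeld modules is
at most `n`. -/
def injdimLE (X : YDCat k H Sinv) (n : ℕ) : Prop :=
  ∃ (I : ℕ → YDCat k H Sinv) (ε : X.M →ₗ[k] (I 0).M)
    (d : ∀ m, (I m).M →ₗ[k] (I (m + 1)).M),
    IsInjRes Sinv X I ε d ∧ ∀ i, n < i → Subsingleton (I i).M

/-- The complex `Hom(X, I⁰) → Hom(X, I¹) → ⋯` of morphism spaces induced by a
cochain of Yetter-Drinfeld modules. -/
def homCx (X : YDCat k H Sinv) (I : ℕ → YDCat k H Sinv)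
    (d : ∀ n, (I n).M →ₗ[k] (I (n + 1)).M)
    (hd : ∀ n, IsHom k H (I n).ρ (I (n + 1)).ρ (d n)) (n : ℕ) :
    ↥(homYD Sinv X (I n)) →ₗ[k] ↥(homYD Sinv X (I (n + 1))) :=
  postcompYD Sinv (d n) (hd n)

/-- Coboundaries of the induced complex. -/
def boundaries (X : YDCat k H Sinv) (I : ℕ → YDCat k H Sinv)
    (d : ∀ n, (I n).M →ₗ[k] (I (n + 1)).M)
    (hd : ∀ n, IsHom k H (I n).ρ (I (n + 1)).ρ (d n)) :
    ∀ i, Submodule k ↥(homYD Sinv X (I i))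
  | 0 => ⊥
  | (i + 1) => LinearMap.range (homCx Sinv X I d hd i)

/-- The `i`-th cohomology (cocycles modulo coboundaries) of the complex
`Hom(X, I⁰) → Hom(X, I¹) → ⋯`; when `I` is an injective resolution of `Y`, this is
`Ext^i(X, Y)`, the `i`-th right derived functor of `Hom_H^H(X, -)`, in the category
of Yetter-Drinfeld modules. -/
abbrev cohomology (X : YDCat k H Sinv) (I : ℕ → YDCat k H Sinv)
    (d : ∀ n, (I n).M →ₗ[k] (I (n + 1)).M)
    (hd : ∀ n, IsHom k H (I n).ρ (I (n + 1)).ρ (d n)) (i : ℕ) : Type :=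
  ↥(Submodule.map (boundaries Sinv X I d hd i).mkQ
      (LinearMap.ker (homCx Sinv X I d hd i)))

end HomYD

section CharProps

variable {k H}
variable (Sinv : H →ₗ[k] H)

/-- Characterizing property of the coaction on `Hom_H(A, B)` for Yetter-Drinfeld
modules `A`, `B`: it is determined by `f₀(m) ⊗ f₁ = f(m₀)₀ ⊗ f(m₀)₁ S(m₁)`. -/
def HomCoactChar (A B : YDCat k H Sinv)
    (ρQ : (A.M →ₗ[H] B.M) →ₗ[k] (A.M →ₗ[H] B.M) ⊗[k] H) : Prop :=
  ∀ (f : A.M →ₗ[H] B.M) (m : A.M) (t : Finset ℕ) (m₀ : ℕ → A.M) (m₁ : ℕ → H),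
    (∑ j ∈ t, m₀ j ⊗ₜ[k] m₁ j) = A.ρ m →
    (LinearMap.rTensor H (evalAtH (N := B.M) m)) (ρQ f) =
      ∑ j ∈ t, (LinearMap.lTensor B.M
          (LinearMap.mulRight k (HopfAlgebra.antipode (R := k) (A := H) (m₁ j))))
        (B.ρ (f (m₀ j)))

/-- Characterizing property of the coaction on `Hom_k(V, B)` for a comodule `V` and
a Yetter-Drinfeld module `B`: `g₀(v) ⊗ g₁ = g(v₀)₀ ⊗ g(v₀)₁ S(v₁)`. -/
def HomKCoactChar (V : ComodCat k H) (B : YDCat k H Sinv)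
    (ρ' : (V.V →ₗ[k] B.M) →ₗ[k] (V.V →ₗ[k] B.M) ⊗[k] H) : Prop :=
  ∀ (g : V.V →ₗ[k] B.M) (v : V.V) (t : Finset ℕ) (v₀ : ℕ → V.V) (v₁ : ℕ → H),
    (∑ j ∈ t, v₀ j ⊗ₜ[k] v₁ j) = V.ρ v →
    (LinearMap.rTensor H (evalAtK (N := B.M) v)) (ρ' g) =
      ∑ j ∈ t, (LinearMap.lTensor B.M
          (LinearMap.mulRight k (HopfAlgebra.antipode (R := k) (A := H) (v₁ j))))
        (B.ρ (g (v₀ j)))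

/-- Characterizing property of the Yetter-Drinfeld coaction on `H ⊗ V`:
`ρ(h ⊗ v) = h₂ ⊗ v₀ ⊗ h₃ v₁ S⁻¹(h₁)`. -/
def HTensorYDChar (V : ComodCat k H)
    (ρT : (H ⊗[k] V.V) →ₗ[k] (H ⊗[k] V.V) ⊗[k] H) : Prop :=
  ∀ (h : H) (v : V.V) (s t : Finset ℕ) (a b c : ℕ → H) (v₀ : ℕ → V.V) (v₁ : ℕ → H),
    (∑ i ∈ s, (a i ⊗ₜ[k] b i) ⊗ₜ[k] c i) = Delta2 k H h →
    (∑ j ∈ t, v₀ j ⊗ₜ[k] v₁ j) = V.ρ v →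
    ρT (h ⊗ₜ[k] v) =
      ∑ i ∈ s, ∑ j ∈ t, (b i ⊗ₜ[k] v₀ j) ⊗ₜ[k] (c i * v₁ j * Sinv (a i))

/-- Characterizing property of the Long dimodule coaction on `H ⊗ V`:
`ρ(h ⊗ v) = h ⊗ v₀ ⊗ v₁`. -/
def HTensorLongChar (V : ComodCat k H)
    (ρT : (H ⊗[k] V.V) →ₗ[k] (H ⊗[k] V.V) ⊗[k] H) : Prop :=
  ∀ (h : H) (v : V.V) (t : Finset ℕ) (v₀ : ℕ → V.V) (v₁ : ℕ → H),
    (∑ j ∈ t, v₀ j ⊗ₜ[k] v₁ j) = V.ρ v →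
    ρT (h ⊗ₜ[k] v) = ∑ j ∈ t, (h ⊗ₜ[k] v₀ j) ⊗ₜ[k] v₁ j

end CharProps

end RingPart

section CommPart

variable {k H : Type} [CommRing k] [CommRing H] [HopfAlgebra k H] (Sinv : H →ₗ[k] H)

/-- Characterizing property of the Yetter-Drinfeld coaction on `M ⊗_H N`:
`ρ(m ⊗ n) = m₀ ⊗ n₀ ⊗ n₁ m₁` (for `H` commutative). -/
def TensorCoactChar (A B : YDCat k H Sinv)
    (ρT : (A.M ⊗[H] B.M) →ₗ[k] (A.M ⊗[H] B.M) ⊗[k] H) : Prop :=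
  ∀ (m : A.M) (n : B.M) (s t : Finset ℕ) (m₀ : ℕ → A.M) (m₁ : ℕ → H)
    (n₀ : ℕ → B.M) (n₁ : ℕ → H),
    (∑ i ∈ s, m₀ i ⊗ₜ[k] m₁ i) = A.ρ m →
    (∑ j ∈ t, n₀ j ⊗ₜ[k] n₁ j) = B.ρ n →
    ρT (m ⊗ₜ[H] n) =
      ∑ i ∈ s, ∑ j ∈ t, (m₀ i ⊗ₜ[H] n₀ j) ⊗ₜ[k] (n₁ j * m₁ i)

/-- Restriction along `v ↦ 1 ⊗ v`, i.e. the canonical map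
`Hom_H(H ⊗ V, N) → Hom_k(V, N)`, `f ↦ (v ↦ f(1 ⊗ v))`. -/
def resUnitMap (V : Type) [AddCommGroup V] [Module k V] (N : Type) [AddCommGroup N]
    [Module k N] [Module H N] [IsScalarTower k H N] [SMulCommClass H k N] :
    ((H ⊗[k] V) →ₗ[H] N) →ₗ[k] (V →ₗ[k] N) where
  toFun f := (f.restrictScalars k).comp ((TensorProduct.mk k H V) 1)
  map_add' f g := by ext v; rfl
  map_smul' c f := by ext v; rfl

end CommPart

section Helpers
open Coalgebra

variable {k H : Type} [Field k] [Ring H] [HopfAlgebra k H]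

/-- `(a ⊗ b) ⊗ (c ⊗ d) ↦ S b c ⊗ S a d` regrouped on `a ⊗ ((b ⊗ c) ⊗ d)`. -/
lemma antipode_convInv :
    (WithConv.toConv ((TensorProduct.map (HopfAlgebra.antipode k (A := H))
        (HopfAlgebra.antipode k (A := H))) ∘ₗ
        (TensorProduct.comm k H H).toLinearMap ∘ₗ (comul : H →ₗ[k] H ⊗[k] H))) *
      WithConv.toConv (comul : H →ₗ[k] H ⊗[k] H) = 1 := by
  apply WithConv.ext
  simp only [LinearMap.convMul_def, LinearMap.convOne_def, WithConv.ofConv_toConv]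
  let S : H →ₗ[k] H := HopfAlgebra.antipode k (A := H)
  let mS : H ⊗[k] H →ₗ[k] H := LinearMap.mul' k H ∘ₗ TensorProduct.map S LinearMap.id
  -- a ⊗ (x ⊗ d) ↦ x ⊗ S a d
  let G : H ⊗[k] (H ⊗[k] H) →ₗ[k] H ⊗[k] H :=
    TensorProduct.map LinearMap.id mS ∘ₗ (TensorProduct.leftComm k H H H).toLinearMap
  have h1 : (LinearMap.mul' k (H ⊗[k] H)) ∘ₗ
      TensorProduct.map (TensorProduct.map S S ∘ₗ (TensorProduct.comm k H H).toLinearMap)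
        LinearMap.id =
      G ∘ₗ LinearMap.lTensor H (LinearMap.rTensor H mS) ∘ₗ
        LinearMap.lTensor H (TensorProduct.assoc k H H H).symm.toLinearMap ∘ₗ
        (TensorProduct.assoc k H H (H ⊗[k] H)).toLinearMap := by
    ext a b c d
    simp [G, mS]
  have h2 : (LinearMap.lTensor H (TensorProduct.assoc k H H H).symm.toLinearMap ∘ₗ
        (TensorProduct.assoc k H H (H ⊗[k] H)).toLinearMap) ∘ₗ
        (TensorProduct.map comul comul) ∘ₗ (comul : H →ₗ[k] H ⊗[k] H) =
      LinearMap.lTensor H (LinearMap.rTensor H comul) ∘ₗ LinearMap.lTensor H comul ∘ₗ comul := by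
    simp only [coassoc_simps]
  have h3 : mS ∘ₗ comul = Algebra.linearMap k H ∘ₗ counit := by
    ext h
    simpa [mS, LinearMap.rTensor] using HopfAlgebra.mul_antipode_rTensor_comul_apply (R := k) h
  have h4 : LinearMap.rTensor H mS ∘ₗ LinearMap.rTensor H comul ∘ₗ comul =
      (TensorProduct.mk k H H 1) := by
    rw [← LinearMap.comp_assoc, ← LinearMap.rTensor_comp, h3]
    ext h
    have := rTensor_counit_comul (R := k) h
    simp [LinearMap.rTensor_comp, this]
  have h5 : G ∘ₗ LinearMap.lTensor H (TensorProduct.mk k H H 1) =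
      TensorProduct.mk k H H 1 ∘ₗ mS := by
    ext a d
    simp [G]
  calc _ = ((LinearMap.mul' k (H ⊗[k] H)) ∘ₗ
      TensorProduct.map (TensorProduct.map S S ∘ₗ (TensorProduct.comm k H H).toLinearMap)
        LinearMap.id) ∘ₗ (TensorProduct.map comul comul) ∘ₗ comul := by
        have e := TensorProduct.map_comp
          (TensorProduct.map S S ∘ₗ (TensorProduct.comm k H H).toLinearMap)
          (LinearMap.id) (comul : H →ₗ[k] H ⊗[k] H) (comul : H →ₗ[k] H ⊗[k] H)
        rw [LinearMap.comp_assoc, ← LinearMap.comp_assoc _ (TensorProduct.map _ _)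
          (TensorProduct.map _ _), ← e]
        rfl
    _ = G ∘ₗ LinearMap.lTensor H (LinearMap.rTensor H mS) ∘ₗ
         LinearMap.lTensor H (LinearMap.rTensor H comul) ∘ₗ LinearMap.lTensor H comul ∘ₗ
           comul := by
        rw [h1, ← h2]; rfl
    _ = G ∘ₗ LinearMap.lTensor H (TensorProduct.mk k H H 1) ∘ₗ comul := by
        rw [← h4]; simp only [LinearMap.lTensor_comp, LinearMap.comp_assoc]
    _ = TensorProduct.mk k H H 1 ∘ₗ mS ∘ₗ comul := by
        rw [← LinearMap.comp_assoc, h5, LinearMap.comp_assoc]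
    _ = _ := by
        rw [h3]; ext h
        simp [Algebra.TensorProduct.algebraMap_apply, Algebra.TensorProduct.tmul_one_eq_one_tmul]

lemma comul_antipode (h : H) :
    comul (R := k) (HopfAlgebra.antipode k h) =
      TensorProduct.map (HopfAlgebra.antipode k (A := H)) (HopfAlgebra.antipode k (A := H))
        (TensorProduct.comm k H H (comul h)) := by
  have := left_inv_eq_right_inv (antipode_convInv (k := k) (H := H)) LinearMap.comul_right_inv
  have := congrArg (fun f => f.ofConv h) this
  simpa using this.symm

lemma Sinv_one {Sinv : H →ₗ[k] H}
    (hS1 : ∀ h : H, Sinv (HopfAlgebra.antipode (R := k) (A := H) h) = h) : Sinv 1 = 1 := by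
  simpa using hS1 1

lemma Sinv_mul {Sinv : H →ₗ[k] H}
    (hS1 : ∀ h : H, Sinv (HopfAlgebra.antipode (R := k) (A := H) h) = h)
    (hS2 : ∀ h : H, HopfAlgebra.antipode (R := k) (A := H) (Sinv h) = h)
    (a b : H) : Sinv (a * b) = Sinv b * Sinv a := by
  rw [← hS1 (Sinv b * Sinv a), HopfAlgebra.antipode_mul_antidistrib, hS2, hS2]

lemma counit_Sinv {Sinv : H →ₗ[k] H}
    (hS2 : ∀ h : H, HopfAlgebra.antipode (R := k) (A := H) (Sinv h) = h)
    (a : H) : counit (R := k) (Sinv a) = counit (R := k) a := by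
  rw [← HopfAlgebra.counit_antipode (R := k) (Sinv a), hS2]

lemma comul_Sinv {Sinv : H →ₗ[k] H}
    (hS1 : ∀ h : H, Sinv (HopfAlgebra.antipode (R := k) (A := H) h) = h)
    (hS2 : ∀ h : H, HopfAlgebra.antipode (R := k) (A := H) (Sinv h) = h)
    (a : H) : comul (R := k) (Sinv a) =
    TensorProduct.comm k H H (TensorProduct.map Sinv Sinv (comul (R := k) a)) := by
  have h := comul_antipode (k := k) (Sinv a)
  rw [hS2] at h
  have e : Sinv ∘ₗ HopfAlgebra.antipode (R := k) (A := H) = LinearMap.id := by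
    ext x; exact hS1 x
  rw [h, ← LinearMap.comp_apply (TensorProduct.map Sinv Sinv), ← TensorProduct.map_comp, e]
  simp

section Act

variable {B P : Type} [AddCommGroup B] [Module k B] [AddCommGroup P] [Module k P]

/-- `(a ⊗ b) ⊗ c` acts on `P ⊗ H` by `p ⊗ g ↦ f b p ⊗ c g S⁻¹(a)`. -/
def actG (Sinv : H →ₗ[k] H) (f : B →ₗ[k] Module.End k P) :
    (H ⊗[k] B) ⊗[k] H →ₗ[k] Module.End k (P ⊗[k] H) :=
  TensorProduct.lift (TensorProduct.lift (LinearMap.mk₂ k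
    (fun a b => (TensorProduct.mapBilinear (.id k) P H P H (f b)) ∘ₗ
      (LinearMap.lcomp k H (LinearMap.mulRight k (Sinv a))) ∘ₗ LinearMap.mul k H)
    (fun a a' b => by ext; simp [mul_add, tmul_add])
    (fun r a b => by ext; simp)
    (fun a b b' => by ext; simp)
    (fun r a b => by ext; simp)))

@[simp] lemma actG_tmul (Sinv : H →ₗ[k] H) (f : B →ₗ[k] Module.End k P) (a : H) (b : B) (c : H)
    (p : P) (g : H) :
    actG Sinv f ((a ⊗ₜ b) ⊗ₜ c) (p ⊗ₜ g) = (f b p) ⊗ₜ[k] (c * g * Sinv a) := by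
  simp [actG, mul_assoc]

lemma actG_comp (Sinv : H →ₗ[k] H) {C : Type} [AddCommGroup C] [Module k C]
    (f : B →ₗ[k] Module.End k P) (u : C →ₗ[k] B) (t : (H ⊗[k] C) ⊗[k] H) :
    actG Sinv (f ∘ₗ u) t = actG Sinv f (LinearMap.rTensor H (LinearMap.lTensor H u) t) := by
  have : actG Sinv (f ∘ₗ u) =
      actG Sinv f ∘ₗ (LinearMap.rTensor H (LinearMap.lTensor H u)) := by
    ext a c b p g
    simp
  rw [this]; rfl

lemma actG_nat (Sinv : H →ₗ[k] H) {Q : Type} [AddCommGroup Q] [Module k Q]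
    (f : B →ₗ[k] Module.End k P) (f' : B →ₗ[k] Module.End k Q) (r : P →ₗ[k] Q)
    (hr : ∀ b p, r (f b p) = f' b (r p)) (t : (H ⊗[k] B) ⊗[k] H) (x : P ⊗[k] H) :
    LinearMap.rTensor H r (actG Sinv f t x) = actG Sinv f' t (LinearMap.rTensor H r x) := by
  have : (LinearMap.lcomp k (Q ⊗[k] H) (LinearMap.rTensor H r)) ∘ₗ actG Sinv f' =
      (LinearMap.llcomp k (P ⊗[k] H) (P ⊗[k] H) (Q ⊗[k] H) (LinearMap.rTensor H r)) ∘ₗ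
        actG Sinv f := by
    ext a c b p g
    simp [hr]
  exact (LinearMap.congr_fun (LinearMap.congr_fun this t) x).symm

end Act

section Phi

variable {N : Type} [AddCommGroup N] [Module k N] [Module H N] [IsScalarTower k H N]
  [SMulCommClass H k N]

variable (N) in
/-- the action map as a linear map -/
def lact : H →ₗ[k] Module.End k N := (Algebra.lsmul k k N).toLinearMap

@[simp] lemma lact_apply (h : H) (n : N) : lact (k := k) N h n = h • n := rfl

variable (N) in
/-- `h` acts on `N ⊗ H` by `n ⊗ g ↦ h₂ n ⊗ h₃ g S⁻¹(h₁)`. -/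
def phi (Sinv : H →ₗ[k] H) : H →ₗ[k] Module.End k (N ⊗[k] H) :=
  actG Sinv (lact N) ∘ₗ Delta2 k H

lemma Delta2_mul (a b : H) : Delta2 k H (a * b) = Delta2 k H a * Delta2 k H b := by
  have : ∀ h, Delta2 k H h = (Algebra.TensorProduct.map (Bialgebra.comulAlgHom k H)
    (AlgHom.id k H)) (Bialgebra.comulAlgHom k H h) := fun h => rfl
  simp only [this, map_mul]

lemma Delta2_one : Delta2 k H 1 = 1 := by
  have : ∀ h, Delta2 k H h = (Algebra.TensorProduct.map (Bialgebra.comulAlgHom k H)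
    (AlgHom.id k H)) (Bialgebra.comulAlgHom k H h) := fun h => rfl
  simp only [this, map_one]

lemma act_mul {Sinv : H →ₗ[k] H}
    (hS1 : ∀ h : H, Sinv (HopfAlgebra.antipode (R := k) (A := H) h) = h)
    (hS2 : ∀ h : H, HopfAlgebra.antipode (R := k) (A := H) (Sinv h) = h)
    (s t : (H ⊗[k] H) ⊗[k] H) :
    actG Sinv (lact N) (s * t) = actG Sinv (lact N) s * actG Sinv (lact N) t := by
  have : (LinearMap.mul k ((H ⊗[k] H) ⊗[k] H)).compr₂ (actG Sinv (lact N)) =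
      (LinearMap.mul k (Module.End k (N ⊗[k] H))).compl₁₂ (actG Sinv (lact N))
        (actG Sinv (lact N)) := by
    ext a b c a' b' c' n g
    simp [Sinv_mul hS1 hS2, mul_smul, mul_assoc]
  exact LinearMap.congr_fun (LinearMap.congr_fun this s) t

lemma phi_mul {Sinv : H →ₗ[k] H}
    (hS1 : ∀ h : H, Sinv (HopfAlgebra.antipode (R := k) (A := H) h) = h)
    (hS2 : ∀ h : H, HopfAlgebra.antipode (R := k) (A := H) (Sinv h) = h)
    (a b : H) (x : N ⊗[k] H) : phi N Sinv (a * b) x = phi N Sinv a (phi N Sinv b x) := by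
  simp [phi, Delta2_mul, act_mul hS1 hS2]

lemma phi_one {Sinv : H →ₗ[k] H}
    (hS1 : ∀ h : H, Sinv (HopfAlgebra.antipode (R := k) (A := H) h) = h)
    (x : N ⊗[k] H) : phi N Sinv 1 x = x := by
  have : phi N Sinv 1 = LinearMap.id := by
    ext n g
    simp [phi, Delta2_one, Algebra.TensorProduct.one_def, Sinv_one hS1]
  rw [this]; rfl

lemma counit_act {Sinv : H →ₗ[k] H}
    (hS2 : ∀ h : H, HopfAlgebra.antipode (R := k) (A := H) (Sinv h) = h)
    (t : (H ⊗[k] H) ⊗[k] H) (n : N) (g : H) :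
    TensorProduct.rid k N (LinearMap.lTensor N (counit (R := k) (A := H))
      (actG Sinv (lact N) t (n ⊗ₜ g))) =
    counit (R := k) g • (TensorProduct.lid k H (LinearMap.rTensor H (counit (R := k) (A := H))
      (TensorProduct.rid k (H ⊗[k] H)
        (LinearMap.lTensor (H ⊗[k] H) (counit (R := k) (A := H)) t)))) • n := by
  induction t with
  | zero => simp
  | add x y hx hy => simp only [map_add, LinearMap.add_apply, hx, hy, add_smul, smul_add]
  | tmul ab c =>
    induction ab with
    | zero => simp
    | add x y hx hy =>
      simp only [add_tmul, map_add, LinearMap.add_apply, hx, hy, add_smul, smul_add]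
    | tmul a b =>
      simp [counit_Sinv hS2, smul_smul]
      congr 1
      ring

lemma counit_phi {Sinv : H →ₗ[k] H}
    (hS2 : ∀ h : H, HopfAlgebra.antipode (R := k) (A := H) (Sinv h) = h)
    (h : H) (x : N ⊗[k] H) :
    TensorProduct.rid k N (LinearMap.lTensor N (counit (R := k) (A := H)) (phi N Sinv h x)) =
    h • TensorProduct.rid k N (LinearMap.lTensor N (counit (R := k) (A := H)) x) := by
  induction x with
  | zero => simp
  | add x y hx hy => simp only [map_add, hx, hy, smul_add]
  | tmul n g =>
    have e : (TensorProduct.lid k H (LinearMap.rTensor H (counit (R := k) (A := H))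
      (TensorProduct.rid k (H ⊗[k] H)
        (LinearMap.lTensor (H ⊗[k] H) (counit (R := k) (A := H)) (Delta2 k H h))))) = h := by
      have : ∀ y : H ⊗[k] H, TensorProduct.rid k (H ⊗[k] H) (LinearMap.lTensor (H ⊗[k] H)
          (counit (R := k) (A := H)) (LinearMap.rTensor H comul y)) =
          comul (TensorProduct.rid k H (LinearMap.lTensor H (counit (R := k) (A := H)) y)) := by
        intro y
        induction y with
        | zero => simp
        | add x y hx hy => simp only [map_add, hx, hy]
        | tmul a b => simp
      simp [Delta2, this]
    simp only [phi, LinearMap.comp_apply, counit_act hS2, e]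
    simp [smul_comm h]

/-- Regrouping of five tensor factors. -/
def regroup : ((H ⊗[k] H) ⊗[k] H) ⊗[k] (H ⊗[k] H) →ₗ[k]
    (H ⊗[k] ((H ⊗[k] H) ⊗[k] H)) ⊗[k] H :=
  LinearMap.rTensor H ((TensorProduct.assoc k H (H ⊗[k] H) H).toLinearMap ∘ₗ
    LinearMap.rTensor H (TensorProduct.assoc k H H H).toLinearMap) ∘ₗ
    (TensorProduct.assoc k ((H ⊗[k] H) ⊗[k] H) H H).symm.toLinearMap

lemma regroup_Delta2 (h : H) :
    regroup (TensorProduct.map (LinearMap.rTensor H comul) comul (Delta2 k H h)) =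
      LinearMap.rTensor H (LinearMap.lTensor H (Delta2 k H)) (Delta2 k H h) := by
  have : regroup ∘ₗ TensorProduct.map (LinearMap.rTensor H comul) comul ∘ₗ Delta2 k H =
      LinearMap.rTensor H (LinearMap.lTensor H (Delta2 k H)) ∘ₗ Delta2 k H := by
    simp only [Delta2, regroup, coassoc_simps]
  exact LinearMap.congr_fun this h

lemma comul_act_aux {Sinv : H →ₗ[k] H} (A C G : H ⊗[k] H) (b : H) (n : N) :
    (TensorProduct.assoc k N H H).symm ((b • n) ⊗ₜ[k]
        (C * G * TensorProduct.comm k H H (TensorProduct.map Sinv Sinv A))) =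
      actG Sinv (actG Sinv (lact N)) (regroup ((A ⊗ₜ b) ⊗ₜ C))
        ((TensorProduct.assoc k N H H).symm (n ⊗ₜ G)) := by
  induction A with
  | zero => simp
  | add x y hx hy =>
    simp only [map_add, mul_add, tmul_add, add_tmul, LinearMap.add_apply, hx, hy]
  | tmul a1 a2 =>
    induction C with
    | zero => simp
    | add x y hx hy =>
      simp only [map_add, add_mul, tmul_add, LinearMap.add_apply, hx, hy]
    | tmul c1 c2 =>
      induction G with
      | zero => simp
      | add x y hx hy =>
        simp only [map_add, mul_add, add_mul, tmul_add, hx, hy]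
      | tmul g1 g2 =>
        simp [regroup]

lemma comul_act {Sinv : H →ₗ[k] H}
    (hS1 : ∀ h : H, Sinv (HopfAlgebra.antipode (R := k) (A := H) h) = h)
    (hS2 : ∀ h : H, HopfAlgebra.antipode (R := k) (A := H) (Sinv h) = h)
    (t : (H ⊗[k] H) ⊗[k] H) (x : N ⊗[k] H) :
    (TensorProduct.assoc k N H H).symm (LinearMap.lTensor N comul (actG Sinv (lact N) t x)) =
      actG Sinv (actG Sinv (lact N))
        (regroup (TensorProduct.map (LinearMap.rTensor H comul) comul t))
        ((TensorProduct.assoc k N H H).symm (LinearMap.lTensor N comul x)) := by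
  induction x with
  | zero => simp
  | add x y hx hy => simp only [map_add, hx, hy]
  | tmul n g =>
    induction t with
    | zero => simp
    | add x y hx hy => simp only [map_add, LinearMap.add_apply, hx, hy]
    | tmul ab c =>
      induction ab with
      | zero => simp
      | add x y hx hy =>
        simp only [add_tmul, map_add, LinearMap.add_apply, hx, hy]
      | tmul a b =>
        simp only [actG_tmul, lact_apply, LinearMap.lTensor_tmul, LinearMap.rTensor_tmul,
          TensorProduct.map_tmul, Bialgebra.comul_mul, comul_Sinv hS1 hS2, comul_act_aux]

lemma coassoc_smul {Sinv : H →ₗ[k] H}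
    (hS1 : ∀ h : H, Sinv (HopfAlgebra.antipode (R := k) (A := H) h) = h)
    (hS2 : ∀ h : H, HopfAlgebra.antipode (R := k) (A := H) (Sinv h) = h)
    (ρ : N →ₗ[k] N ⊗[k] H) (hρ : ∀ (h : H) (n : N), ρ (h • n) = phi N Sinv h (ρ n))
    (h : H) (n : N)
    (hn : (TensorProduct.assoc k N H H) ((LinearMap.rTensor H ρ) (ρ n)) =
      (LinearMap.lTensor N (comul (R := k) (A := H))) (ρ n)) :
    (TensorProduct.assoc k N H H) ((LinearMap.rTensor H ρ) (ρ (h • n))) =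
      (LinearMap.lTensor N (comul (R := k) (A := H))) (ρ (h • n)) := by
  rw [← LinearEquiv.eq_symm_apply] at hn ⊢
  rw [hρ]
  simp only [phi, LinearMap.comp_apply]
  rw [comul_act hS1 hS2, ← hn, regroup_Delta2, ← actG_comp]
  have e := actG_nat Sinv (lact N) (phi N Sinv) ρ
    (by intro b p; rw [lact_apply]; exact hρ b p) (Delta2 k H h) (ρ n)
  rw [e, phi]

lemma exists_sum_nat {ι X : Type} [AddCommMonoid X] (f : ι → X)
    (hf : AddSubmonoid.closure (Set.range f) = ⊤) (i₀ : ι) (x : X) :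
    ∃ (s : Finset ℕ) (g : ℕ → ι), ∑ i ∈ s, f (g i) = x := by
  have hx : x ∈ AddSubmonoid.closure (Set.range f) := hf ▸ AddSubmonoid.mem_top x
  obtain ⟨l, hl, rfl⟩ := AddSubmonoid.exists_list_of_mem_closure hx
  clear hx
  have : ∃ l' : List ι, l = l'.map f := by
    induction l with
    | nil => exact ⟨[], rfl⟩
    | cons a l ih =>
      obtain ⟨l', rfl⟩ := ih (fun y hy => hl y (List.mem_cons_of_mem _ hy))
      obtain ⟨i, rfl⟩ := hl a (by simp)
      exact ⟨i :: l', rfl⟩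
  obtain ⟨l', rfl⟩ := this
  refine ⟨Finset.range l'.length, fun i => l'.getD i i₀, ?_⟩
  rw [Finset.sum_range, ← Fin.sum_univ_fun_getElem]
  exact Finset.sum_congr rfl (fun i _ => by simp)

lemma exists_sum_tmul {X Y : Type} [AddCommGroup X] [Module k X] [AddCommGroup Y] [Module k Y]
    (x : X ⊗[k] Y) : ∃ (s : Finset ℕ) (a : ℕ → X) (b : ℕ → Y), ∑ i ∈ s, a i ⊗ₜ[k] b i = x := by
  obtain ⟨s, g, h⟩ := exists_sum_nat (fun p : X × Y => p.1 ⊗ₜ[k] p.2) (by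
    rw [eq_top_iff]
    rintro x -
    induction x with
    | zero => exact zero_mem _
    | add x y hx hy => exact add_mem hx hy
    | tmul a b => exact AddSubmonoid.subset_closure ⟨(a, b), rfl⟩) (0, 0) x
  exact ⟨s, fun i => (g i).1, fun i => (g i).2, h⟩

lemma exists_sum_tmul₃ (x : (H ⊗[k] H) ⊗[k] H) : ∃ (s : Finset ℕ) (a b c : ℕ → H),
    ∑ i ∈ s, (a i ⊗ₜ[k] b i) ⊗ₜ[k] c i = x := by
  obtain ⟨s, g, h⟩ := exists_sum_nat (fun p : H × H × H => (p.1 ⊗ₜ[k] p.2.1) ⊗ₜ[k] p.2.2) (by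
    rw [eq_top_iff]
    rintro x -
    induction x with
    | zero => exact zero_mem _
    | add x y hx hy => exact add_mem hx hy
    | tmul a b =>
      induction a with
      | zero => simp
      | add x y hx hy => rw [add_tmul]; exact add_mem hx hy
      | tmul a c => exact AddSubmonoid.subset_closure ⟨(a, c, b), rfl⟩) (0, 0, 0) x
  exact ⟨s, fun i => (g i).1, fun i => (g i).2.1, fun i => (g i).2.2, h⟩

lemma phi_sum {Sinv : H →ₗ[k] H} {h : H} {x : N ⊗[k] H}
    {s t : Finset ℕ} {a b c : ℕ → H} {m₀ : ℕ → N} {m₁ : ℕ → H}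
    (hs : (∑ i ∈ s, (a i ⊗ₜ[k] b i) ⊗ₜ[k] c i) = Delta2 k H h)
    (ht : (∑ j ∈ t, m₀ j ⊗ₜ[k] m₁ j) = x) :
    phi N Sinv h x =
      ∑ i ∈ s, ∑ j ∈ t, (b i • m₀ j) ⊗ₜ[k] (c i * m₁ j * Sinv (a i)) := by
  simp only [phi, LinearMap.comp_apply, ← hs, ← ht, map_sum, LinearMap.sum_apply, actG_tmul,
    lact_apply]
  rw [Finset.sum_comm]

lemma isYDCompat_iff {Sinv : H →ₗ[k] H} (ρ : N →ₗ[k] N ⊗[k] H) :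
    IsYDCompat k H Sinv ρ ↔ ∀ (h : H) (n : N), ρ (h • n) = phi N Sinv h (ρ n) := by
  constructor
  · intro H1 h n
    obtain ⟨s, a, b, c, hs⟩ := exists_sum_tmul₃ (Delta2 k H h)
    obtain ⟨t, m₀, m₁, ht⟩ := exists_sum_tmul (ρ n)
    rw [H1 h n s t a b c m₀ m₁ hs ht, phi_sum hs ht]
  · intro H1 h n s t a b c m₀ m₁ hs ht
    rw [H1, phi_sum hs ht]

end Phi

end Helpers

section Constructions
open Coalgebra

variable {k H : Type} [Field k] [Ring H] [HopfAlgebra k H]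

/-- The map `v ⊗ g ↦ (1 ⊗ v) ⊗ g`. -/
def unitT (V : Type) [AddCommGroup V] [Module k V] : V ⊗[k] H →ₗ[k] (H ⊗[k] V) ⊗[k] H :=
  LinearMap.rTensor H (TensorProduct.mk k H V 1)

/-- The Yetter-Drinfeld coaction on `H ⊗ V`. -/
def rhoYD (Sinv : H →ₗ[k] H) {V : Type} [AddCommGroup V] [Module k V]
    (ρ : V →ₗ[k] V ⊗[k] H) : (H ⊗[k] V) →ₗ[k] (H ⊗[k] V) ⊗[k] H :=
  TensorProduct.lift ((LinearMap.lcomp k _ (unitT V ∘ₗ ρ)) ∘ₗ phi (H ⊗[k] V) Sinv)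

lemma rhoYD_tmul (Sinv : H →ₗ[k] H) {V : Type} [AddCommGroup V] [Module k V]
    (ρ : V →ₗ[k] V ⊗[k] H) (h : H) (v : V) :
    rhoYD Sinv ρ (h ⊗ₜ v) = phi (H ⊗[k] V) Sinv h (unitT V (ρ v)) := by
  simp [rhoYD]

lemma rhoYD_smul {Sinv : H →ₗ[k] H}
    (hS1 : ∀ h : H, Sinv (HopfAlgebra.antipode (R := k) (A := H) h) = h)
    (hS2 : ∀ h : H, HopfAlgebra.antipode (R := k) (A := H) (Sinv h) = h)
    {V : Type} [AddCommGroup V] [Module k V]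
    (ρ : V →ₗ[k] V ⊗[k] H) (h : H) (x : H ⊗[k] V) :
    rhoYD Sinv ρ (h • x) = phi (H ⊗[k] V) Sinv h (rhoYD Sinv ρ x) := by
  induction x with
  | zero => simp
  | add x y hx hy => simp only [smul_add, map_add, hx, hy]
  | tmul a v => rw [smul_tmul', smul_eq_mul, rhoYD_tmul, rhoYD_tmul, phi_mul hS1 hS2]

/-- Coassociativity transported along a map commuting with coactions. -/
lemma comod_transport {V W : Type} [AddCommGroup V] [Module k V] [AddCommGroup W] [Module k W]
    (ρ : V →ₗ[k] V ⊗[k] H) (σ : W →ₗ[k] W ⊗[k] H) (f : V →ₗ[k] W)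
    (hf : ∀ v, σ (f v) = LinearMap.rTensor H f (ρ v)) (v : V) :
    (TensorProduct.assoc k W H H) ((LinearMap.rTensor H σ) (σ (f v))) =
      LinearMap.rTensor (H ⊗[k] H) f
        ((TensorProduct.assoc k V H H) ((LinearMap.rTensor H ρ) (ρ v))) ∧
    (LinearMap.lTensor W (comul (R := k) (A := H))) (σ (f v)) =
      LinearMap.rTensor (H ⊗[k] H) f
       ((LinearMap.lTensor V (comul (R := k) (A := H))) (ρ v)) ∧
    TensorProduct.rid k W (LinearMap.lTensor W (counit (R := k) (A := H)) (σ (f v))) =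
      f (TensorProduct.rid k V (LinearMap.lTensor V (counit (R := k) (A := H)) (ρ v))) := by
  rw [hf]
  generalize ρ v = x
  induction x with
  | zero => simp
  | add x y hx hy =>
    simp only [map_add]
    exact ⟨by rw [hx.1, hy.1], by rw [hx.2.1, hy.2.1], by rw [hx.2.2, hy.2.2]⟩
  | tmul a g =>
    refine ⟨?_, ?_, ?_⟩
    · simp only [LinearMap.rTensor_tmul, hf]
      generalize ρ a = y
      induction y with
      | zero => simp
      | add x y hx hy => simp only [map_add, add_tmul, hx, hy]
      | tmul b c => simp
    · simp
    · simp

lemma rhoYD_comod {Sinv : H →ₗ[k] H}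
    (hS1 : ∀ h : H, Sinv (HopfAlgebra.antipode (R := k) (A := H) h) = h)
    (hS2 : ∀ h : H, HopfAlgebra.antipode (R := k) (A := H) (Sinv h) = h)
    {V : Type} [AddCommGroup V] [Module k V]
    (ρ : V →ₗ[k] V ⊗[k] H) (hρ : IsComod k H ρ) : IsComod k H (rhoYD Sinv ρ) := by
  have h1 : ∀ v, rhoYD Sinv ρ (TensorProduct.mk k H V 1 v) =
      LinearMap.rTensor H (TensorProduct.mk k H V 1) (ρ v) := fun v => by
    simp only [TensorProduct.mk_apply, rhoYD_tmul, phi_one hS1]; rfl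
  have e : ∀ (a : H) (v : V), a ⊗ₜ[k] v = a • (TensorProduct.mk k H V 1 v) := fun a v => by
    simp [smul_tmul']
  constructor
  · intro x
    induction x with
    | zero => simp
    | add x y hx hy => simp only [map_add, hx, hy]
    | tmul a v =>
      rw [e, rhoYD_smul hS1 hS2, counit_phi hS2, (comod_transport ρ _ _ h1 v).2.2, hρ.1]
  · intro x
    induction x with
    | zero => simp
    | add x y hx hy => simp only [map_add, hx, hy]
    | tmul a v =>
      rw [e]
      apply coassoc_smul hS1 hS2 _ (rhoYD_smul hS1 hS2 ρ)
      rw [(comod_transport ρ _ _ h1 v).1, (comod_transport ρ _ _ h1 v).2.1, hρ.2]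

lemma rhoYD_char {Sinv : H →ₗ[k] H} (V : ComodCat k H) :
    HTensorYDChar Sinv V (rhoYD Sinv V.ρ) := by
  intro h v s t a b c v₀ v₁ hs ht
  have : (∑ j ∈ t, ((1 : H) ⊗ₜ[k] v₀ j) ⊗ₜ[k] v₁ j) = unitT V.V (V.ρ v) := by
    rw [← ht]; simp [unitT]
  rw [rhoYD_tmul, phi_sum hs this]
  simp [smul_tmul']

/-- The Long coaction on `H ⊗ V`. -/
def rhoL {V : Type} [AddCommGroup V] [Module k V]
    (ρ : V →ₗ[k] V ⊗[k] H) : (H ⊗[k] V) →ₗ[k] (H ⊗[k] V) ⊗[k] H :=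
  (TensorProduct.assoc k H V H).symm.toLinearMap ∘ₗ LinearMap.lTensor H ρ

lemma rhoL_compat {V : Type} [AddCommGroup V] [Module k V]
    (ρ : V →ₗ[k] V ⊗[k] H) : IsLongCompat k H (rhoL ρ) := by
  intro h x
  induction x with
  | zero => simp
  | add x y hx hy => simp only [smul_add, map_add, hx, hy]
  | tmul a v =>
    simp only [smul_tmul', rhoL, LinearMap.comp_apply, LinearMap.lTensor_tmul,
      LinearEquiv.coe_coe]
    generalize ρ v = y
    induction y with
    | zero => simp
    | add x y hx hy => simp only [map_add, tmul_add, hx, hy]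
    | tmul b c => simp [smulMap, smul_tmul']

lemma rhoL_tmul {V : Type} [AddCommGroup V] [Module k V]
    (ρ : V →ₗ[k] V ⊗[k] H) (a : H) (v : V) : rhoL ρ (TensorProduct.mk k H V a v) =
      LinearMap.rTensor H (TensorProduct.mk k H V a) (ρ v) := by
  simp only [TensorProduct.mk_apply, rhoL, LinearMap.comp_apply, LinearMap.lTensor_tmul,
      LinearEquiv.coe_coe]
  generalize ρ v = y
  induction y with
  | zero => simp
  | add x y hx hy => simp only [map_add, tmul_add, hx, hy]
  | tmul b c => simp

lemma rhoL_comod {V : Type} [AddCommGroup V] [Module k V]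
    (ρ : V →ₗ[k] V ⊗[k] H) (hρ : IsComod k H ρ) : IsComod k H (rhoL ρ) := by
  constructor
  · intro x
    induction x with
    | zero => simp
    | add x y hx hy => simp only [map_add, hx, hy]
    | tmul a v =>
      have := (comod_transport ρ _ _ (rhoL_tmul ρ a) v).2.2
      rw [hρ.1] at this
      exact this
  · intro x
    induction x with
    | zero => simp
    | add x y hx hy => simp only [map_add, hx, hy]
    | tmul a v =>
      have := (comod_transport ρ _ _ (rhoL_tmul ρ a) v).1
      rw [hρ.2, ← (comod_transport ρ _ _ (rhoL_tmul ρ a) v).2.1] at this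
      exact this

lemma rhoL_char (V : ComodCat k H) : HTensorLongChar V (rhoL V.ρ) := by
  intro h v t v₀ v₁ ht
  have := rhoL_tmul V.ρ h v
  rw [← ht] at this
  simpa using this

/-- A finite set in a comodule lies in a finite dimensional subcomodule. -/
lemma exists_finite_subcomod {M : Type} [AddCommGroup M] [Module k M] (ρ : M →ₗ[k] M ⊗[k] H)
    (hρ : IsComod k H ρ) (S : Finset M) :
    ∃ V : ComodCat k H, FiniteDimensional k V.V ∧ ∃ i : V.V →ₗ[k] M,
      (∀ v, ρ (i v) = LinearMap.rTensor H i (V.ρ v)) ∧ ∀ m ∈ S, m ∈ LinearMap.range i := by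
  classical
  -- the contraction maps
  let con : M →ₗ[k] Module.Dual k H →ₗ[k] M :=
    LinearMap.flip ((LinearMap.lcomp k M ρ) ∘ₗ
      (LinearMap.llcomp k (M ⊗[k] H) (M ⊗[k] k) M (TensorProduct.rid k M).toLinearMap) ∘ₗ
      LinearMap.lTensorHom M)
  have hcon : ∀ m φ, con m φ = contract φ (ρ m) := fun m φ => rfl
  let W : Submodule k M := ⨆ m ∈ S, LinearMap.range (con m)
  have hfin : ∀ x : M ⊗[k] H, ∃ U : Submodule k M, FiniteDimensional k U ∧
      ∀ φ : Module.Dual k H, contract φ x ∈ U := by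
    intro x
    induction x with
    | zero => exact ⟨⊥, inferInstance, fun φ => by simp⟩
    | add x y hx hy =>
      obtain ⟨U, hU, h1⟩ := hx
      obtain ⟨U', hU', h2⟩ := hy
      exact ⟨U ⊔ U', inferInstance, fun φ => by
        rw [map_add]; exact add_mem (Submodule.mem_sup_left (h1 φ)) (Submodule.mem_sup_right (h2 φ))⟩
    | tmul m g =>
      exact ⟨Submodule.span k {m}, inferInstance, fun φ => by
        simp only [contract, LinearMap.comp_apply, LinearMap.lTensor_tmul, LinearEquiv.coe_coe,
          TensorProduct.rid_tmul]
        exact Submodule.smul_mem _ _ (Submodule.mem_span_singleton_self m)⟩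
  have hWfin : FiniteDimensional k W := by
    have : ∀ m, FiniteDimensional k (LinearMap.range (con m)) := by
      intro m
      obtain ⟨U, hU, h1⟩ := hfin (ρ m)
      apply Submodule.finiteDimensional_of_le (S₂ := U)
      rintro _ ⟨φ, rfl⟩
      exact h1 φ
    exact Submodule.finiteDimensional_finset_sup S (fun m => LinearMap.range (con m)) |> fun h => by
      rw [Finset.sup_eq_iSup] at h; exact h
  -- stability under contraction
  have hcc : ∀ (ψ φ : Module.Dual k H) (m : M), ∃ χ : Module.Dual k H,
      contract ψ (ρ (con m φ)) = con m χ := by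
    intro ψ φ m
    refine ⟨(TensorProduct.lid k k).toLinearMap ∘ₗ TensorProduct.map ψ φ ∘ₗ comul, ?_⟩
    have h1 : ∀ x : M ⊗[k] H, contract ψ (ρ (contract φ x)) =
        TensorProduct.rid k M (LinearMap.lTensor M ((TensorProduct.lid k k).toLinearMap ∘ₗ
          TensorProduct.map ψ φ) (TensorProduct.assoc k M H H (LinearMap.rTensor H ρ x))) := by
      intro x
      induction x with
      | zero => simp
      | add x y hx hy => simp only [map_add, hx, hy]
      | tmul n g =>
        simp only [contract, LinearMap.comp_apply, LinearMap.lTensor_tmul, LinearEquiv.coe_coe,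
          TensorProduct.rid_tmul, map_smul, LinearMap.rTensor_tmul]
        generalize ρ n = y
        induction y with
        | zero => simp
        | add x y hx hy => simp only [map_add, smul_add, add_tmul, hx, hy]
        | tmul b c => simp [smul_smul, mul_comm]
    rw [hcon, h1, hρ.2, hcon, contract, LinearMap.comp_apply, ← LinearMap.comp_apply
      (LinearMap.lTensor M _), ← LinearMap.lTensor_comp]
    rfl
  have hstab : ∀ w ∈ W, ∀ ψ : Module.Dual k H, contract ψ (ρ w) ∈ W := by
    intro w hw ψ
    have : W ≤ W.comap (contract ψ ∘ₗ ρ) := by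
      refine iSup₂_le fun m hm => ?_
      rintro _ ⟨φ, rfl⟩
      obtain ⟨χ, hχ⟩ := hcc ψ φ m
      rw [Submodule.mem_comap, LinearMap.comp_apply, hχ]
      exact Submodule.mem_iSup_of_mem m (Submodule.mem_iSup_of_mem hm ⟨χ, rfl⟩)
    exact this hw
  have hmemS : ∀ m ∈ S, m ∈ W := fun m hm =>
    Submodule.mem_iSup_of_mem m (Submodule.mem_iSup_of_mem hm ⟨counit, hρ.1 m⟩)
  -- elements all of whose contractions are in `W`
  have hrange : ∀ x : M ⊗[k] H, (∀ ψ : Module.Dual k H, contract ψ x ∈ W) →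
      x ∈ LinearMap.range (LinearMap.rTensor H W.subtype) := by
    intro x hx
    let b := Module.Basis.ofVectorSpace k H
    obtain ⟨c, rfl⟩ := TensorProduct.eq_repr_basis_right b x
    have hc : ∀ j, c j ∈ W := by
      intro j
      have h := hx (b.coord j)
      have e : contract (b.coord j) (c.sum fun i m => m ⊗ₜ[k] b i) = c j := by
        rw [map_finsuppSum]
        simp [contract, Finsupp.single_apply, Finsupp.sum]
        exact fun h0 => h0.symm
      rwa [e] at h
    refine Submodule.sum_mem _ fun j _ => ?_
    exact ⟨(⟨c j, hc j⟩ : W) ⊗ₜ b j, by simp⟩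
  have hinj : ∀ (Q : Type) [AddCommGroup Q] [Module k Q],
      Function.Injective (LinearMap.rTensor Q W.subtype) := fun Q _ _ =>
    Module.Flat.rTensor_preserves_injective_linearMap _ W.injective_subtype
  let e := LinearEquiv.ofInjective (LinearMap.rTensor H W.subtype) (hinj H)
  let ρW : W →ₗ[k] W ⊗[k] H := e.symm.toLinearMap ∘ₗ
    (ρ ∘ₗ W.subtype).codRestrict (LinearMap.range (LinearMap.rTensor H W.subtype))
      (fun w => hrange _ (hstab w w.2))
  have hρW : ∀ w, ρ (W.subtype w) = LinearMap.rTensor H W.subtype (ρW w) := by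
    intro w
    have : (e (ρW w) : M ⊗[k] H) = ρ (W.subtype w) := by
      simp [ρW]
    rw [← this]; rfl
  have hcomod : IsComod k H ρW := by
    constructor
    · intro w
      apply W.injective_subtype
      rw [← (comod_transport ρW ρ W.subtype hρW w).2.2, hρ.1]
    · intro w
      apply hinj (H ⊗[k] H)
      rw [← (comod_transport ρW ρ W.subtype hρW w).1,
        ← (comod_transport ρW ρ W.subtype hρW w).2.1, hρ.2]
  exact ⟨⟨W, ρW, hcomod⟩, hWfin, W.subtype, hρW, fun m hm => ⟨⟨m, hmemS m hm⟩, rfl⟩⟩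

section Final

variable {M : Type} [AddCommGroup M] [Module k M] [Module H M] [IsScalarTower k H M]
  [SMulCommClass H k M]

/-- The map `h ⊗ v ↦ h • i v`. -/
def piMap {V : Type} [AddCommGroup V] [Module k V] (i : V →ₗ[k] M) : H ⊗[k] V →ₗ[k] M :=
  TensorProduct.lift ((LinearMap.lcomp k M i) ∘ₗ lact M)

lemma piMap_tmul {V : Type} [AddCommGroup V] [Module k V] (i : V →ₗ[k] M) (h : H) (v : V) :
    piMap i (h ⊗ₜ[k] v) = h • i v := by
  simp [piMap]

lemma piMap_smul {V : Type} [AddCommGroup V] [Module k V] (i : V →ₗ[k] M) (h : H)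
    (x : H ⊗[k] V) : piMap i (h • x) = h • piMap i x := by
  induction x with
  | zero => simp
  | add x y hx hy => simp only [smul_add, map_add, hx, hy]
  | tmul a v => simp [smul_tmul', piMap_tmul, mul_smul]

lemma piMap_surj {V : Type} [AddCommGroup V] [Module k V] (i : V →ₗ[k] M) (S : Finset M)
    (hS : Submodule.span H (S : Set M) = ⊤) (hi : ∀ m ∈ S, m ∈ LinearMap.range i) :
    Function.Surjective (piMap (H := H) i) := by
  let f : H ⊗[k] V →ₗ[H] M :=
    { toFun := piMap i, map_add' := map_add _, map_smul' := fun h x => piMap_smul i h x }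
  have : LinearMap.range f = ⊤ := by
    rw [eq_top_iff, ← hS, Submodule.span_le]
    intro m hm
    obtain ⟨v, rfl⟩ := hi m hm
    exact ⟨1 ⊗ₜ v, by change piMap i _ = _; simp [piMap_tmul]⟩
  exact (LinearMap.range_eq_top (f := f)).1 this

lemma finite_of_surj {V : Type} [AddCommGroup V] [Module k V] [FiniteDimensional k V]
    (π : H ⊗[k] V →ₗ[k] M) (h1 : ∀ (h : H) (a : H ⊗[k] V), π (h • a) = h • π a)
    (h2 : Function.Surjective π) : Module.Finite H M := by
  let f : H ⊗[k] V →ₗ[H] M :=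
    { toFun := π, map_add' := map_add _, map_smul' := h1 }
  exact Module.Finite.of_surjective f h2

lemma piMap_homYD {Sinv : H →ₗ[k] H} (ρM : M →ₗ[k] M ⊗[k] H) (hM : IsYDCompat k H Sinv ρM)
    {V : Type} [AddCommGroup V] [Module k V] (ρ : V →ₗ[k] V ⊗[k] H) (i : V →ₗ[k] M)
    (hi : ∀ v, ρM (i v) = LinearMap.rTensor H i (ρ v)) :
    IsHom k H (rhoYD Sinv ρ) ρM (piMap i) := by
  refine ⟨piMap_smul i, ?_⟩
  ext h v
  have e : piMap i ∘ₗ TensorProduct.mk k H V 1 = i := by ext v; simp [piMap_tmul]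
  have := actG_nat Sinv (lact (H ⊗[k] V)) (lact M) (piMap i)
    (fun b p => piMap_smul i b p) (Delta2 k H h) (unitT V (ρ v))
  simp only [TensorProduct.AlgebraTensorModule.curry_apply, TensorProduct.curry_apply,
    LinearMap.restrictScalars_self, LinearMap.comp_apply, piMap_tmul, rhoYD_tmul,
    (isYDCompat_iff ρM).1 hM, hi, phi]
  rw [this, unitT, ← LinearMap.rTensor_comp_apply, e]

lemma piMap_homL (ρM : M →ₗ[k] M ⊗[k] H) (hM : IsLongCompat k H ρM)
    {V : Type} [AddCommGroup V] [Module k V] (ρ : V →ₗ[k] V ⊗[k] H) (i : V →ₗ[k] M)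
    (hi : ∀ v, ρM (i v) = LinearMap.rTensor H i (ρ v)) :
    IsHom k H (rhoL ρ) ρM (piMap i) := by
  refine ⟨piMap_smul i, ?_⟩
  ext h v
  have e : piMap i ∘ₗ TensorProduct.mk k H V h = smulMap k H h ∘ₗ i := by
    ext v; simp [piMap_tmul, smulMap]
  change ρM (piMap i (h ⊗ₜ v)) = LinearMap.rTensor H (piMap i) (rhoL ρ (TensorProduct.mk k H V h v))
  rw [piMap_tmul, hM, rhoL_tmul, hi, ← LinearMap.rTensor_comp_apply,
    ← LinearMap.rTensor_comp_apply, e]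

end Final

end Constructions

/-- Proposition 1.6. Let `k` be a field and `H` a Hopf algebra
over `k` with bijective antipode. An object `M` of the category of Yetter-Drinfeld
modules (respectively of Long dimodules) is finitely generated as a left `H`-module
if and only if there exist a finite dimensional right `H`-comodule `V` and an
`H`-linear `H`-colinear epimorphism `π : H ⊗ V → M`, where `H ⊗ V` carries the
Yetter-Drinfeld structure `h(h' ⊗ v) = hh' ⊗ v`,
`ρ(h ⊗ v) = h₂ ⊗ v₀ ⊗ h₃ v₁ S⁻¹(h₁)` (respectively the Long dimodule structure
`ρ(h ⊗ v) = h ⊗ v₀ ⊗ v₁`). -/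
theorem fg_iff_quotient_of_H_tensor_comodule
    (k H : Type) [Field k] [Ring H] [HopfAlgebra k H]
    (Sinv : H →ₗ[k] H)
    (hS1 : ∀ h : H, Sinv (HopfAlgebra.antipode (R := k) (A := H) h) = h)
    (hS2 : ∀ h : H, HopfAlgebra.antipode (R := k) (A := H) (Sinv h) = h) :
    (∀ A : YDCat k H Sinv,
      Module.Finite H A.M ↔
        ∃ V : ComodCat k H, FiniteDimensional k V.V ∧
          ∃ ρT : (H ⊗[k] V.V) →ₗ[k] (H ⊗[k] V.V) ⊗[k] H,
            (∀ (h h' : H) (v : V.V), h • (h' ⊗ₜ[k] v) = (h * h') ⊗ₜ[k] v) ∧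
            IsComod k H ρT ∧ IsYDCompat k H Sinv ρT ∧ HTensorYDChar Sinv V ρT ∧
            ∃ π : (H ⊗[k] V.V) →ₗ[k] A.M,
              IsHom k H ρT A.ρ π ∧ Function.Surjective π) ∧
    (∀ A : LongCat k H,
      Module.Finite H A.M ↔
        ∃ V : ComodCat k H, FiniteDimensional k V.V ∧
          ∃ ρT : (H ⊗[k] V.V) →ₗ[k] (H ⊗[k] V.V) ⊗[k] H,
            (∀ (h h' : H) (v : V.V), h • (h' ⊗ₜ[k] v) = (h * h') ⊗ₜ[k] v) ∧
            IsComod k H ρT ∧ IsLongCompat k H ρT ∧ HTensorLongChar V ρT ∧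
            ∃ π : (H ⊗[k] V.V) →ₗ[k] A.M,
              IsHom k H ρT A.ρ π ∧ Function.Surjective π) := by
  refine ⟨fun A => ⟨fun hA => ?_, ?_⟩, fun A => ⟨fun hA => ?_, ?_⟩⟩
  · obtain ⟨S, hS⟩ := hA.fg_top
    obtain ⟨V, hV, i, hi, hSi⟩ := exists_finite_subcomod A.ρ A.comod S
    exact ⟨V, hV, rhoYD Sinv V.ρ, fun h h' v => by simp [smul_tmul'],
      rhoYD_comod hS1 hS2 _ V.comod,
      (isYDCompat_iff _).2 (rhoYD_smul hS1 hS2 _), rhoYD_char V, piMap i,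
      piMap_homYD A.ρ A.compat V.ρ i hi, piMap_surj i S hS hSi⟩
  · rintro ⟨V, hV, ρT, -, -, -, -, π, hπ, hsurj⟩
    exact finite_of_surj π hπ.1 hsurj
  · obtain ⟨S, hS⟩ := hA.fg_top
    obtain ⟨V, hV, i, hi, hSi⟩ := exists_finite_subcomod A.ρ A.comod S
    exact ⟨V, hV, rhoL V.ρ, fun h h' v => by simp [smul_tmul'],
      rhoL_comod _ V.comod, rhoL_compat _, rhoL_char V, piMap i,
      piMap_homL A.ρ A.compat V.ρ i hi, piMap_surj i S hS hSi⟩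
  · rintro ⟨V, hV, ρT, -, -, -, -, π, hπ, hsurj⟩
    exact finite_of_surj π hπ.1 hsurj
end YDPaper
end
end

section
/- Let H be a commutative Hopf algebra with bijective antipode over a commutative ring k (faithfully flat over k), and let M, N be left-right Yetter-Drinfeld modules over H. Then Hom_H(M, N) is a left H*-submodule of Hom_k(M, N), where H* is the linear dual of H acting on Hom_k(M, N) by (h* · f)(m) = h*( f(m_0)_1 S(m_1) ) f(m_0)_0; that is, if f : M → N is left H-linear then so is h* · f for every h* in H*. -/
/-!
Common definitions for formalizing "Semisimplicity of the categories of
Yetter-Drinfeld modules and Long dimodules" (Caenepeel, Guédénon).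
-/

open TensorProduct

noncomputable section
namespace YDPaper

section Helpers

open WithConv

lemma exists_nat_sum {ι X : Type*} [Inhabited ι] [AddCommMonoid X] (φ : ι → X) {x : X}
    (hx : x ∈ AddSubmonoid.closure (Set.range φ)) :
    ∃ (n : ℕ) (e : ℕ → ι), ∑ i ∈ Finset.range n, φ (e i) = x := by
  induction hx using AddSubmonoid.closure_induction with
  | mem x hx =>
    obtain ⟨i, rfl⟩ := hx
    exact ⟨1, fun _ => i, by simp⟩
  | zero => exact ⟨0, fun _ => default, by simp⟩
  | add x y _ _ hx hy =>
    obtain ⟨n, e, rfl⟩ := hx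
    obtain ⟨n', e', rfl⟩ := hy
    refine ⟨n + n', fun i => if i < n then e i else e' (i - n), ?_⟩
    rw [Finset.sum_range_add]
    congr 1
    · refine Finset.sum_congr rfl fun i hi => ?_
      simp [Finset.mem_range.1 hi]
    · refine Finset.sum_congr rfl fun i _ => ?_
      simp

lemma exists_sum_two {k A B : Type} [CommRing k] [AddCommGroup A] [Module k A]
    [AddCommGroup B] [Module k B] (x : A ⊗[k] B) :
    ∃ (t : Finset ℕ) (a : ℕ → A) (b : ℕ → B), ∑ i ∈ t, a i ⊗ₜ[k] b i = x := by
  have hx : x ∈ AddSubmonoid.closure (Set.range fun p : A × B => p.1 ⊗ₜ[k] p.2) := by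
    induction x with
    | zero => exact zero_mem _
    | tmul a b => exact AddSubmonoid.subset_closure ⟨(a, b), rfl⟩
    | add x y hx hy => exact add_mem hx hy
  haveI : Inhabited (A × B) := ⟨0⟩
  obtain ⟨n, e, he⟩ := exists_nat_sum _ hx
  exact ⟨Finset.range n, fun i => (e i).1, fun i => (e i).2, he⟩

lemma exists_sum_three {k A : Type} [CommRing k] [AddCommGroup A] [Module k A]
    (x : (A ⊗[k] A) ⊗[k] A) :
    ∃ (t : Finset ℕ) (a b c : ℕ → A), ∑ i ∈ t, (a i ⊗ₜ[k] b i) ⊗ₜ[k] c i = x := by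
  have hx : x ∈ AddSubmonoid.closure
      (Set.range fun p : A × A × A => (p.1 ⊗ₜ[k] p.2.1) ⊗ₜ[k] p.2.2) := by
    induction x with
    | zero => exact zero_mem _
    | tmul y c =>
      induction y with
      | zero => rw [TensorProduct.zero_tmul]; exact zero_mem _
      | tmul a b => exact AddSubmonoid.subset_closure ⟨(a, b, c), rfl⟩
      | add x y hx hy => rw [TensorProduct.add_tmul]; exact add_mem hx hy
    | add x y hx hy => exact add_mem hx hy
  haveI : Inhabited (A × A × A) := ⟨0⟩
  obtain ⟨n, e, he⟩ := exists_nat_sum _ hx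
  exact ⟨Finset.range n, fun i => (e i).1, fun i => (e i).2.1, fun i => (e i).2.2, he⟩

variable {k H : Type} [CommRing k] [CommRing H] [HopfAlgebra k H]

/-- `H ⊗ H` acting on `M ⊗ H`. -/
def act (M : Type) [AddCommGroup M] [Module k M] [Module H M] [IsScalarTower k H M]
    [SMulCommClass H k M] : H ⊗[k] H →ₐ[k] Module.End k (M ⊗[k] H) :=
  (Module.endTensorEndAlgHom (R := k) (S := k) (A := k) (M := M) (N := H)).comp
    (Algebra.TensorProduct.map (Algebra.lsmul k k M) (Algebra.lmul k H))

lemma act_tmul (M : Type) [AddCommGroup M] [Module k M] [Module H M] [IsScalarTower k H M]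
    [SMulCommClass H k M] (a b c : H) (m : M) :
    act (k := k) M (a ⊗ₜ b) (m ⊗ₜ c) = (a • m) ⊗ₜ (b * c) := by
  simp [act, Module.endTensorEndAlgHom_apply]

/-- left and right inclusions -/
def iL : H →ₐ[k] H ⊗[k] H := Algebra.TensorProduct.includeLeft
/-- left and right inclusions -/
def iR : H →ₐ[k] H ⊗[k] H := Algebra.TensorProduct.includeRight

/-- triple product of linear maps -/
def triple {A : Type} [CommRing A] [Algebra k A] (u v w : H →ₗ[k] A) :
    (H ⊗[k] H) ⊗[k] H →ₗ[k] A :=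
  LinearMap.mul' k A ∘ₗ TensorProduct.map (LinearMap.mul' k A ∘ₗ TensorProduct.map u v) w

lemma triple_Delta2 {A : Type} [CommRing A] [Algebra k A] (u v w : H →ₗ[k] A) :
    (triple u v w) ∘ₗ (Delta2 k H) = (toConv u * toConv v * toConv w).ofConv := by
  ext h
  simp only [LinearMap.convMul_def, triple, Delta2, LinearMap.comp_apply]
  congr 1
  rw [← LinearMap.comp_apply, LinearMap.rTensor, ← TensorProduct.map_comp, LinearMap.comp_id]
  rfl

lemma id_mul_Sinv (Sinv : H →ₗ[k] H)
    (hS1 : ∀ h : H, Sinv (HopfAlgebra.antipode (R := k) (A := H) h) = h)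
    (hS2 : ∀ h : H, HopfAlgebra.antipode (R := k) (A := H) (Sinv h) = h) :
    toConv (LinearMap.id : H →ₗ[k] H) * toConv Sinv = 1 := by
  have hinj : Function.Injective (HopfAlgebra.antipode k (A := H)) :=
    Function.LeftInverse.injective hS1
  have h1 := LinearMap.algHom_comp_convMul_distrib (HopfAlgebra.antipodeAlgHom k H)
    (toConv (LinearMap.id : H →ₗ[k] H)) (toConv Sinv)
  have h2 : (HopfAlgebra.antipodeAlgHom k H).toLinearMap ∘ₗ Sinv = LinearMap.id := by
    ext h; exact hS2 h
  have h3 := LinearMap.algHom_comp_convOne (R := k) (A := H) (HopfAlgebra.antipodeAlgHom k H)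
  simp only [h2] at h1
  rw [HopfAlgebra.toLinearMap_antipodeAlgHom, LinearMap.comp_id, LinearMap.antipode_mul_id] at h1
  rw [HopfAlgebra.toLinearMap_antipodeAlgHom] at h3
  ext h
  apply hinj
  refine (LinearMap.congr_fun h1 h).trans ?_
  simp [Algebra.algebraMap_eq_smul_one, HopfAlgebra.antipode_one]

/-- the coaction element `h₂ ⊗ h₃ S⁻¹(h₁)` before applying `Δ²` -/
def psi (Sinv : H →ₗ[k] H) : (H ⊗[k] H) ⊗[k] H →ₗ[k] H ⊗[k] H :=
  triple (iR.toLinearMap ∘ₗ Sinv) iL.toLinearMap iR.toLinearMap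

lemma psi_tmul (Sinv : H →ₗ[k] H) (a b c : H) :
    psi Sinv ((a ⊗ₜ b) ⊗ₜ c) = b ⊗ₜ[k] (Sinv a * c) := by
  simp [psi, triple, iL, iR]

lemma key (Sinv : H →ₗ[k] H)
    (hS1 : ∀ h : H, Sinv (HopfAlgebra.antipode (R := k) (A := H) h) = h)
    (hS2 : ∀ h : H, HopfAlgebra.antipode (R := k) (A := H) (Sinv h) = h) (h : H) :
    triple iR.toLinearMap (psi Sinv ∘ₗ Delta2 k H)
      (iR.toLinearMap ∘ₗ HopfAlgebra.antipode k (A := H)) (Delta2 k H h) = h ⊗ₜ[k] 1 := by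
  have h0 : (1 : WithConv (H →ₗ[k] H ⊗[k] H)).ofConv =
      (iR (k := k) (H := H)).toLinearMap ∘ₗ (1 : WithConv (H →ₗ[k] H)).ofConv := by
    ext h; simp
  have hA : toConv (iR (k := k) (H := H)).toLinearMap * toConv (iR.toLinearMap ∘ₗ Sinv) = 1 := by
    apply ofConv_injective
    rw [h0, ← id_mul_Sinv Sinv hS1 hS2, LinearMap.algHom_comp_convMul_distrib]
    rfl
  have hB : toConv (iR (k := k) (H := H)).toLinearMap *
      toConv (iR.toLinearMap ∘ₗ HopfAlgebra.antipode k (A := H)) = 1 := by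
    apply ofConv_injective
    rw [h0, ← LinearMap.id_mul_antipode, LinearMap.algHom_comp_convMul_distrib]
    rfl
  rw [← LinearMap.comp_apply, triple_Delta2, psi, triple_Delta2, toConv_ofConv,
    mul_assoc, mul_assoc, mul_assoc, hB, mul_one, ← mul_assoc, hA, one_mul]
  rfl

lemma coact_smul (Sinv : H →ₗ[k] H) (M : YDCat k H Sinv) (h : H) (m : M.M) :
    M.ρ (h • m) = act (k := k) M.M (psi Sinv (Delta2 k H h)) (M.ρ m) := by
  obtain ⟨s, a, b, c, hs⟩ := exists_sum_three (Delta2 k H h)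
  obtain ⟨t, m₀, m₁, ht⟩ := exists_sum_two (M.ρ m)
  rw [M.compat h m s t a b c m₀ m₁ hs ht, ← hs, ← ht]
  simp only [map_sum, LinearMap.sum_apply, psi_tmul, act_tmul]
  rw [Finset.sum_comm]
  refine Finset.sum_congr rfl fun j _ => Finset.sum_congr rfl fun i _ => ?_
  congr 1; ring

lemma contract_act (N : Type) [AddCommGroup N] [Module k N] [Module H N] [IsScalarTower k H N]
    [SMulCommClass H k N] (φ : H →ₗ[k] k) (u : H) (x : N ⊗[k] H) :
    contract (φ.comp (LinearMap.mulRight k u)) x =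
      contract φ (act (k := k) N (1 ⊗ₜ u) x) := by
  induction x with
  | zero => simp
  | tmul n c => simp [act_tmul, contract, mul_comm]
  | add x y hx hy => simp only [map_add, hx, hy]

lemma contract_act_left (N : Type) [AddCommGroup N] [Module k N] [Module H N]
    [IsScalarTower k H N]
    [SMulCommClass H k N] (φ : H →ₗ[k] k) (h : H) (x : N ⊗[k] H) :
    contract φ (act (k := k) N (h ⊗ₜ 1) x) = h • contract φ x := by
  induction x with
  | zero => simp
  | tmul n c =>
    simp only [act_tmul, contract, LinearMap.comp_apply, LinearMap.lTensor_tmul,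
      LinearEquiv.coe_coe, TensorProduct.rid_tmul, one_mul]
    exact (smul_comm h (φ c) n).symm
  | add x y hx hy => simp only [map_add, hx, hy, smul_add]

/-- linear form of the action `h* · f` -/
def dualAct {M N : Type} [AddCommGroup M] [Module k M]
    [AddCommGroup N] [Module k N] [Module H N] [IsScalarTower k H N] [SMulCommClass H k N]
    (φ : H →ₗ[k] k) (r : M →ₗ[k] N ⊗[k] H) : M ⊗[k] H →ₗ[k] N :=
  contract φ ∘ₗ TensorProduct.lift
    (((act (k := k) (H := H) N).toLinearMap ∘ₗ iR.toLinearMap ∘ₗ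
      HopfAlgebra.antipode k (A := H)).flip ∘ₗ r)

lemma dualAct_tmul {M N : Type} [AddCommGroup M] [Module k M]
    [AddCommGroup N] [Module k N] [Module H N] [IsScalarTower k H N] [SMulCommClass H k N]
    (φ : H →ₗ[k] k) (r : M →ₗ[k] N ⊗[k] H) (m : M) (u : H) :
    dualAct φ r (m ⊗ₜ u) =
      contract φ (act (k := k) N (1 ⊗ₜ HopfAlgebra.antipode k u) (r m)) := rfl

lemma dualAct_psi (Sinv : H →ₗ[k] H)
    (hS2 : ∀ h : H, HopfAlgebra.antipode (R := k) (A := H) (Sinv h) = h)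
    (M N : YDCat k H Sinv) (φ : H →ₗ[k] k)
    (f : M.M →ₗ[k] N.M) (hf : ∀ (h : H) (m : M.M), f (h • m) = h • f m)
    (t : (H ⊗[k] H) ⊗[k] H) (m : M.M) (u : H) :
    dualAct φ (N.ρ ∘ₗ f) (act (k := k) M.M (psi Sinv t) (m ⊗ₜ u)) =
      contract φ (act (k := k) N.M
        (triple iR.toLinearMap (psi Sinv ∘ₗ Delta2 k H)
          (iR.toLinearMap ∘ₗ HopfAlgebra.antipode k (A := H)) t *
          (1 ⊗ₜ HopfAlgebra.antipode k u)) (N.ρ (f m))) := by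
  induction t with
  | zero => simp
  | add x y hx hy => simp only [map_add, add_mul, LinearMap.add_apply, hx, hy]
  | tmul y c =>
    induction y with
    | zero => simp
    | add x y hx hy =>
      simp only [TensorProduct.add_tmul, map_add, add_mul, LinearMap.add_apply, hx, hy]
    | tmul a b =>
      rw [psi_tmul, act_tmul, dualAct_tmul, LinearMap.comp_apply, hf, coact_smul,
        ← Module.End.mul_apply, ← map_mul]
      congr 3
      simp only [triple, LinearMap.comp_apply, TensorProduct.map_tmul, LinearMap.mul'_apply,
        AlgHom.toLinearMap_apply, iR, Algebra.TensorProduct.includeRight_apply,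
        HopfAlgebra.antipode_mul_distrib, hS2]
      have e : (1 : H) ⊗ₜ[k] (a * HopfAlgebra.antipode k c * HopfAlgebra.antipode k u) =
          ((1 : H) ⊗ₜ[k] a) * (1 ⊗ₜ HopfAlgebra.antipode k c) *
            (1 ⊗ₜ HopfAlgebra.antipode k u) := by simp
      rw [e]; ring

end Helpers

/-- Lemma 1.7. Let `H` be a commutative Hopf algebra with
bijective antipode over a commutative ring `k`, faithfully flat over `k`, and let
`M`, `N` be Yetter-Drinfeld modules. Then `Hom_H(M, N)` is an `H*`-submodule of
`Hom_k(M, N)` for the action `(h* · f)(m) = h*(f(m₀)₁ S(m₁)) f(m₀)₀`: if `f` is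
left `H`-linear, then so is `h* · f` (here `g = h* · f` is characterized pointwise
via Sweedler decompositions of `ρ_M(m)`). -/
theorem dual_action_preserves_H_linearity
    (k H : Type) [CommRing k] [CommRing H] [HopfAlgebra k H]
    [Module.FaithfullyFlat k H]
    (Sinv : H →ₗ[k] H)
    (hS1 : ∀ h : H, Sinv (HopfAlgebra.antipode (R := k) (A := H) h) = h)
    (hS2 : ∀ h : H, HopfAlgebra.antipode (R := k) (A := H) (Sinv h) = h)
    (M N : YDCat k H Sinv)
    (hstar : H →ₗ[k] k)
    (f : M.M →ₗ[k] N.M) (hf : ∀ (h : H) (m : M.M), f (h • m) = h • f m)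
    (g : M.M → N.M)
    (hg : ∀ (m : M.M) (t : Finset ℕ) (m₀ : ℕ → M.M) (m₁ : ℕ → H),
      (∑ j ∈ t, m₀ j ⊗ₜ[k] m₁ j) = M.ρ m →
      g m = ∑ j ∈ t,
        contract (hstar.comp
            (LinearMap.mulRight k (HopfAlgebra.antipode (R := k) (A := H) (m₁ j))))
          (N.ρ (f (m₀ j)))) :
    ∀ (h : H) (m : M.M), g (h • m) = h • g m := by
  have hG : ∀ m, g m = dualAct hstar (N.ρ ∘ₗ f) (M.ρ m) := by
    intro m
    obtain ⟨t, m₀, m₁, ht⟩ := exists_sum_two (M.ρ m)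
    rw [hg m t m₀ m₁ ht, ← ht, map_sum]
    refine Finset.sum_congr rfl fun j _ => ?_
    rw [contract_act, dualAct_tmul, LinearMap.comp_apply]
  intro h m
  rw [hG, hG, coact_smul]
  generalize M.ρ m = x
  induction x with
  | zero => simp
  | add x y hx hy => simp only [map_add, smul_add, hx, hy]
  | tmul m u =>
    rw [dualAct_psi Sinv hS2 M N hstar f hf, key Sinv hS1 hS2, map_mul, Module.End.mul_apply,
      contract_act_left, dualAct_tmul, LinearMap.comp_apply]
end YDPaper
end
end
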